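/- arXiv:2304.13822 — 3 statements merged into one kernel-verified Lean document; each statement's English description precedes it below -/
import Mathlib

section
/- Let Ω be a nonempty bounded open subset of ℝ⁴, let λ₁, λ₂ ∈ ℝ, μ₁, μ₂ > 0, θ₁, θ₂ > 0 and β > 0. Set C := max{ μ₁ + β + θ₁e^{λ₁/θ₁−1}, μ₂ + β + θ₂e^{λ₂/θ₂−1} }. Then every pair u, v ∈ C_c^∞(Ω) with (u, v) ≠ (0, 0) satisfying ℒ'(u,v)(u,v) = 0 fulfills ∫_Ω(u⁺)⁴ + ∫_Ω(v⁺)⁴ ≥ S²/(2C²). In particular there is a constant C₃ > 0, depending only on β, μ₁, μ₂, λ₁, λ₂, θ₁, θ₂, such that ∫_Ω(u⁺)⁴ + ∫_Ω(v⁺)⁴ ≥ C₃ for all such pairs. -/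
open MeasureTheory

noncomputable section

/-- The space `ℝ⁴`, with its Lebesgue measure. -/
abbrev E4 : Type := EuclideanSpace ℝ (Fin 4)

/-- `C_c^∞(Ω)`: smooth real-valued functions with compact support contained in `Ω`,
extended by zero to `ℝ⁴`. -/
def TestFun (Ω : Set E4) (u : E4 → ℝ) : Prop :=
  ContDiff ℝ (⊤ : ℕ∞) u ∧ HasCompactSupport u ∧ tsupport u ⊆ Ω

/-- The positive part `u⁺ = max{u, 0}`. -/
def pp (u : E4 → ℝ) (x : E4) : ℝ := max (u x) 0

/-- The squared norm `|∇u|²` of the gradient. -/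
def gradSq (u : E4 → ℝ) (x : E4) : ℝ := ‖fderiv ℝ u x‖ ^ 2

/-- The best Sobolev constant `S` of the embedding `D^{1,2}(ℝ⁴) ↪ L⁴(ℝ⁴)`. -/
def sobolevS : ℝ :=
  sInf { r : ℝ | ∃ w : E4 → ℝ, ContDiff ℝ (⊤ : ℕ∞) w ∧ HasCompactSupport w ∧ w ≠ 0 ∧
    r = (∫ x, gradSq w x) / (∫ x, (w x) ^ 4) ^ ((1 : ℝ) / 2) }

/-- The first Dirichlet eigenvalue `λ₁(Ω)` of `−Δ` on `Ω`, as the infimum of the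
Rayleigh quotient over test functions. -/
def lamOne (Ω : Set E4) : ℝ :=
  sInf { r : ℝ | ∃ w : E4 → ℝ, TestFun Ω w ∧ w ≠ 0 ∧
    r = (∫ x in Ω, gradSq w x) / (∫ x in Ω, (w x) ^ 2) }

/-- The modified energy functional `ℒ(u,v)` of the system. -/
def LL (Ω : Set E4) (lam1 mu1 th1 lam2 mu2 th2 β : ℝ) (u v : E4 → ℝ) : ℝ :=
  (1 / 2) * (∫ x in Ω, gradSq u x) - (lam1 / 2) * (∫ x in Ω, (pp u x) ^ 2)
    - (mu1 / 4) * (∫ x in Ω, (pp u x) ^ 4)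
    - (th1 / 2) * (∫ x in Ω, (pp u x) ^ 2 * (Real.log ((pp u x) ^ 2) - 1))
    + (1 / 2) * (∫ x in Ω, gradSq v x) - (lam2 / 2) * (∫ x in Ω, (pp v x) ^ 2)
    - (mu2 / 4) * (∫ x in Ω, (pp v x) ^ 4)
    - (th2 / 2) * (∫ x in Ω, (pp v x) ^ 2 * (Real.log ((pp v x) ^ 2) - 1))
    - (β / 2) * (∫ x in Ω, (pp u x) ^ 2 * (pp v x) ^ 2)

/-- The pairing `ℒ'(u,v)(u,v)` of the derivative of the energy with `(u,v)`. -/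
def LLp (Ω : Set E4) (lam1 mu1 th1 lam2 mu2 th2 β : ℝ) (u v : E4 → ℝ) : ℝ :=
  (∫ x in Ω, gradSq u x) + (∫ x in Ω, gradSq v x)
    - lam1 * (∫ x in Ω, (pp u x) ^ 2) - lam2 * (∫ x in Ω, (pp v x) ^ 2)
    - mu1 * (∫ x in Ω, (pp u x) ^ 4) - mu2 * (∫ x in Ω, (pp v x) ^ 4)
    - 2 * β * (∫ x in Ω, (pp u x) ^ 2 * (pp v x) ^ 2)
    - th1 * (∫ x in Ω, (pp u x) ^ 2 * Real.log ((pp u x) ^ 2))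
    - th2 * (∫ x in Ω, (pp v x) ^ 2 * Real.log ((pp v x) ^ 2))


lemma gns_aux : ∃ c : ℝ, 0 < c ∧ ∀ w : E4 → ℝ, ContDiff ℝ (⊤ : ℕ∞) w → HasCompactSupport w →
    c * √(∫ x, (w x) ^ 4) ≤ ∫ x, gradSq w x := by
  set K := eLpNormLESNormFDerivOfEqInnerConst (volume : Measure E4) (((2 : NNReal)) : ℝ) with hK
  refine ⟨1 / ((K : ℝ) ^ 2 + 1), by positivity, ?_⟩
  intro w hw hc
  have h1 : ContDiff ℝ 1 w := hw.of_le (by exact_mod_cast le_top)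
  have hcf : Continuous (fderiv ℝ w) := h1.continuous_fderiv (by norm_num)
  have hcs : HasCompactSupport (fderiv ℝ w) := hc.fderiv (𝕜 := ℝ)
  have hmain := eLpNorm_le_eLpNorm_fderiv_of_eq_inner (volume : Measure E4) h1 hc
    (p := 2) (p' := 4) (by norm_num) (by simp) (by simp; norm_num)
  rw [← hK] at hmain
  have m1 : MemLp w ((4 : NNReal) : ENNReal) (volume : Measure E4) :=
    h1.continuous.memLp_of_hasCompactSupport hc
  have m2 : MemLp (fderiv ℝ w) ((2 : NNReal) : ENNReal) (volume : Measure E4) :=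
    hcf.memLp_of_hasCompactSupport hcs
  rw [m1.eLpNorm_eq_integral_rpow_norm (by simp) (by simp),
    m2.eLpNorm_eq_integral_rpow_norm (by simp) (by simp)] at hmain
  have e1 : ∀ x, ‖w x‖ ^ (((4 : NNReal) : ENNReal).toReal) = (w x) ^ 4 := by
    intro x
    have : (((4 : NNReal) : ENNReal).toReal) = ((4 : ℕ) : ℝ) := by simp
    rw [this, Real.rpow_natCast, Real.norm_eq_abs]
    exact Even.pow_abs (by decide) _
  have e2 : ∀ x, ‖fderiv ℝ w x‖ ^ (((2 : NNReal) : ENNReal).toReal) = gradSq w x := by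
    intro x
    have : (((2 : NNReal) : ENNReal).toReal) = ((2 : ℕ) : ℝ) := by simp
    rw [this, Real.rpow_natCast, gradSq]
  simp_rw [e1, e2] at hmain
  have hI : 0 ≤ ∫ x, (w x) ^ 4 := integral_nonneg fun x => by positivity
  have hG : 0 ≤ ∫ x, gradSq w x := integral_nonneg fun x => by unfold gradSq; positivity
  set I := ∫ x, (w x) ^ 4
  set G := ∫ x, gradSq w x
  rw [← ENNReal.ofReal_coe_nnreal (p := K), ← ENNReal.ofReal_mul (by positivity),
    ENNReal.ofReal_le_ofReal_iff (by positivity)] at hmain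
  have hsq := pow_le_pow_left₀ (by positivity) hmain 2
  have f1 : (I ^ (((4 : NNReal) : ENNReal).toReal)⁻¹) ^ 2 = √I := by
    rw [← Real.rpow_natCast, ← Real.rpow_mul hI, Real.sqrt_eq_rpow]
    congr 1; simp; norm_num
  have f2 : (G ^ (((2 : NNReal) : ENNReal).toReal)⁻¹) ^ 2 = G := by
    rw [← Real.rpow_natCast, ← Real.rpow_mul hG]
    simp
  rw [mul_pow, f1, f2] at hsq
  rw [one_div, inv_mul_le_iff₀ (by positivity)]
  nlinarith

lemma pp_cont {u : E4 → ℝ} (hu : Continuous u) : Continuous (pp u) := by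
  unfold pp; fun_prop

lemma pp_cs {u : E4 → ℝ} (hu : HasCompactSupport u) : HasCompactSupport (pp u) := by
  have := hu.comp_left (g := fun t : ℝ => max t 0) (by simp)
  exact this

lemma int_comp {g : ℝ → ℝ} (hg : Continuous g) (g0 : g 0 = 0) {u : E4 → ℝ} (hu : Continuous u)
    (hc : HasCompactSupport u) : Integrable (fun x => g (u x)) :=
  (hg.comp hu).integrable_of_hasCompactSupport (hc.comp_left g0)

lemma pt_ineq (lam th t : ℝ) (hth : 0 < th) (ht : 0 ≤ t) :
    lam * t + th * (t * Real.log t) ≤ th * Real.exp (lam / th - 1) * t ^ 2 := by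
  rcases ht.eq_or_lt with rfl | ht
  · simp
  have h := Real.log_le_sub_one_of_pos (x := t * Real.exp (lam / th - 1)) (by positivity)
  rw [Real.log_mul ht.ne' (Real.exp_pos _).ne', Real.log_exp] at h
  have h2 : Real.log t + lam / th ≤ t * Real.exp (lam / th - 1) := by linarith
  have h3 := mul_le_mul_of_nonneg_left h2 (mul_pos hth ht).le
  have h4 : th * t * (Real.log t + lam / th) = lam * t + th * (t * Real.log t) := by
    field_simp; ring
  nlinarith

lemma single (Ω : Set E4) (lam th : ℝ) (hth : 0 < th) {u : E4 → ℝ} (hu : Continuous u)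
    (hc : HasCompactSupport u) :
    lam * (∫ x in Ω, (pp u x) ^ 2) + th * (∫ x in Ω, (pp u x) ^ 2 * Real.log ((pp u x) ^ 2)) ≤
      th * Real.exp (lam / th - 1) * ∫ x in Ω, (pp u x) ^ 4 := by
  have i2 : IntegrableOn (fun x => (pp u x) ^ 2) Ω :=
    (int_comp (g := fun t => t ^ 2) (by fun_prop) (by simp) (pp_cont hu) (pp_cs hc)).integrableOn
  have i4 : IntegrableOn (fun x => (pp u x) ^ 4) Ω :=
    (int_comp (g := fun t => t ^ 4) (by fun_prop) (by simp) (pp_cont hu) (pp_cs hc)).integrableOn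
  have il : IntegrableOn (fun x => (pp u x) ^ 2 * Real.log ((pp u x) ^ 2)) Ω :=
    (int_comp (g := fun t => t ^ 2 * Real.log (t ^ 2))
      (Real.continuous_mul_log.comp (continuous_pow 2)) (by simp)
      (pp_cont hu) (pp_cs hc)).integrableOn
  rw [← integral_const_mul, ← integral_const_mul, ← integral_const_mul,
    ← integral_add (i2.const_mul _) (il.const_mul _)]
  refine integral_mono ((i2.const_mul _).add (il.const_mul _)) (i4.const_mul _) ?_
  intro x
  have := pt_ineq lam th ((pp u x) ^ 2) hth (sq_nonneg _)
  calc _ ≤ _ := this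
    _ = _ := by ring

lemma cross (Ω : Set E4) {u v : E4 → ℝ} (hu : Continuous u) (hc : HasCompactSupport u)
    (hv : Continuous v) (hcv : HasCompactSupport v) :
    2 * (∫ x in Ω, (pp u x) ^ 2 * (pp v x) ^ 2) ≤
      (∫ x in Ω, (pp u x) ^ 4) + ∫ x in Ω, (pp v x) ^ 4 := by
  have i4 : IntegrableOn (fun x => (pp u x) ^ 4) Ω :=
    (int_comp (g := fun t => t ^ 4) (by fun_prop) (by simp) (pp_cont hu) (pp_cs hc)).integrableOn
  have j4 : IntegrableOn (fun x => (pp v x) ^ 4) Ω :=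
    (int_comp (g := fun t => t ^ 4) (by fun_prop) (by simp) (pp_cont hv) (pp_cs hcv)).integrableOn
  have ic : IntegrableOn (fun x => (pp u x) ^ 2 * (pp v x) ^ 2) Ω := by
    refine Integrable.integrableOn (Continuous.integrable_of_hasCompactSupport
      (((pp_cont hu).pow 2).mul ((pp_cont hv).pow 2)) ?_)
    have h := (pp_cs hc).comp_left (g := fun t : ℝ => t ^ 2) (by simp)
    exact HasCompactSupport.mul_right h
  rw [← integral_const_mul, ← integral_add i4 j4]
  refine integral_mono (ic.const_mul _) (i4.add j4) ?_
  intro x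
  show 2 * ((pp u x) ^ 2 * (pp v x) ^ 2) ≤ (pp u x) ^ 4 + (pp v x) ^ 4
  nlinarith [sq_nonneg ((pp u x) ^ 2 - (pp v x) ^ 2)]

lemma grad_full {Ω : Set E4} {u : E4 → ℝ} (hu : TestFun Ω u) :
    ∫ x in Ω, gradSq u x = ∫ x, gradSq u x := by
  apply setIntegral_eq_integral_of_forall_compl_eq_zero
  intro x hx
  have : fderiv ℝ u x = 0 := fderiv_of_notMem_tsupport ℝ (fun h => hx (hu.2.2 h))
  simp [gradSq, this]

lemma pp_le {Ω : Set E4} {u : E4 → ℝ} (hu : TestFun Ω u) :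
    ∫ x in Ω, (pp u x) ^ 4 ≤ ∫ x, (u x) ^ 4 := by
  have i4 : Integrable (fun x => (pp u x) ^ 4) :=
    int_comp (g := fun t => t ^ 4) (by fun_prop) (by simp) (pp_cont hu.1.continuous) (pp_cs hu.2.1)
  have j4 : Integrable (fun x => (u x) ^ 4) :=
    int_comp (g := fun t => t ^ 4) (by fun_prop) (by simp) hu.1.continuous hu.2.1
  refine (setIntegral_le_integral i4 (Filter.Eventually.of_forall fun x => by positivity)).trans ?_
  refine integral_mono i4 j4 fun x => ?_
  show (max (u x) 0) ^ 4 ≤ (u x) ^ 4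
  rcases le_total (u x) 0 with h | h
  · rw [max_eq_right h, zero_pow (by norm_num)]; positivity
  · rw [max_eq_left h]

lemma zero_of {u : E4 → ℝ} (hu : Continuous u) (hc : HasCompactSupport u)
    (h : ∫ x, (u x) ^ 4 ≤ 0) : u = 0 := by
  by_contra hne
  obtain ⟨x, hx⟩ := Function.ne_iff.1 hne
  have := Continuous.integral_pos_of_hasCompactSupport_nonneg_nonzero (μ := (volume : Measure E4))
    (f := fun x => (u x) ^ 4) (hu.pow 4) (hc.comp_left (g := fun t : ℝ => t ^ 4) (by simp))
    (fun x => by positivity) (x := x) (by simpa using hx)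
  linarith

lemma core (Ω : Set E4) (lam1 lam2 μ₁ μ₂ θ₁ θ₂ β : ℝ) (hμ₁ : 0 < μ₁) 
    (hθ₁ : 0 < θ₁) (hθ₂ : 0 < θ₂) (hβ : 0 < β) (K : ℝ) (hK : 0 ≤ K)
    (hKS : ∀ w : E4 → ℝ, ContDiff ℝ (⊤ : ℕ∞) w → HasCompactSupport w →
      K * √(∫ x, (w x) ^ 4) ≤ ∫ x, gradSq w x)
    (u v : E4 → ℝ) (hu : TestFun Ω u) (hv : TestFun Ω v) (hne : ¬(u = 0 ∧ v = 0))
    (hL : LLp Ω lam1 μ₁ θ₁ lam2 μ₂ θ₂ β u v = 0) :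
    (∫ x in Ω, (pp u x) ^ 4) + (∫ x in Ω, (pp v x) ^ 4) ≥
        K ^ 2 / (2 * (max (μ₁ + β + θ₁ * Real.exp (lam1 / θ₁ - 1))
          (μ₂ + β + θ₂ * Real.exp (lam2 / θ₂ - 1))) ^ 2) := by
  have s1 := single Ω lam1 θ₁ hθ₁ hu.1.continuous hu.2.1
  have s2 := single Ω lam2 θ₂ hθ₂ hv.1.continuous hv.2.1
  have s3 := cross Ω hu.1.continuous hu.2.1 hv.1.continuous hv.2.1
  have a0 : 0 ≤ ∫ x in Ω, (pp u x) ^ 4 := integral_nonneg fun x => by positivity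
  have b0 : 0 ≤ ∫ x in Ω, (pp v x) ^ 4 := integral_nonneg fun x => by positivity
  have g1 := (mul_le_mul_of_nonneg_left (Real.sqrt_le_sqrt (pp_le hu)) hK).trans
    (hKS u hu.1 hu.2.1)
  have g2 := (mul_le_mul_of_nonneg_left (Real.sqrt_le_sqrt (pp_le hv)) hK).trans
    (hKS v hv.1 hv.2.1)
  have hA : 0 ≤ ∫ x, gradSq u x := integral_nonneg fun x => by unfold gradSq; positivity
  have hB : 0 ≤ ∫ x, gradSq v x := integral_nonneg fun x => by unfold gradSq; positivity
  have c1 := le_max_left (μ₁ + β + θ₁ * Real.exp (lam1 / θ₁ - 1))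
          (μ₂ + β + θ₂ * Real.exp (lam2 / θ₂ - 1))
  have c2 := le_max_right (μ₁ + β + θ₁ * Real.exp (lam1 / θ₁ - 1))
          (μ₂ + β + θ₂ * Real.exp (lam2 / θ₂ - 1))
  have c0 : 0 < max (μ₁ + β + θ₁ * Real.exp (lam1 / θ₁ - 1))
          (μ₂ + β + θ₂ * Real.exp (lam2 / θ₂ - 1)) := lt_of_lt_of_le (by positivity) c1
  unfold LLp at hL
  rw [grad_full hu, grad_full hv] at hL
  obtain ⟨c, hc, hcS⟩ := gns_aux
  have k1 := hcS u hu.1 hu.2.1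
  have k2 := hcS v hv.1 hv.2.1
  have z1 := zero_of hu.1.continuous hu.2.1
  have z2 := zero_of hv.1.continuous hv.2.1
  generalize max (μ₁ + β + θ₁ * Real.exp (lam1 / θ₁ - 1))
          (μ₂ + β + θ₂ * Real.exp (lam2 / θ₂ - 1)) = C at *
  generalize (∫ x in Ω, (pp u x) ^ 4) = a at *
  generalize (∫ x in Ω, (pp v x) ^ 4) = b at *
  generalize (∫ x, gradSq u x) = A at *
  generalize (∫ x, gradSq v x) = B at *
  have key : A + B ≤ C * (a + b) := by
    have := mul_le_mul_of_nonneg_right c1 a0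
    have := mul_le_mul_of_nonneg_right c2 b0
    have := mul_le_mul_of_nonneg_left s3 hβ.le
    nlinarith
  have hpos : 0 < a + b := by
    by_contra hn
    have h0 : a + b = 0 := by linarith
    rw [h0] at key
    have hA0 : A = 0 := by linarith
    have hB0 : B = 0 := by linarith
    refine hne ⟨z1 ?_, z2 ?_⟩
    · exact Real.sqrt_eq_zero'.1 (le_antisymm (by nlinarith) (Real.sqrt_nonneg _))
    · exact Real.sqrt_eq_zero'.1 (le_antisymm (by nlinarith) (Real.sqrt_nonneg _))
  have hs : 0 < √(a + b) := Real.sqrt_pos.2 hpos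
  have hss : √(a + b) ^ 2 = a + b := Real.sq_sqrt hpos.le
  have hsub : √(a + b) ≤ √a + √b := by
    apply Real.sqrt_le_iff.2 ⟨by positivity, _⟩
    nlinarith [Real.sq_sqrt a0, Real.sq_sqrt b0, Real.sqrt_nonneg a, Real.sqrt_nonneg b,
      mul_nonneg (Real.sqrt_nonneg a) (Real.sqrt_nonneg b)]
  have h1 : K * √(a + b) ≤ C * √(a + b) * √(a + b) := by
    have := mul_le_mul_of_nonneg_left hsub hK
    nlinarith
  have h2 : K ≤ C * √(a + b) := le_of_mul_le_mul_right h1 hs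
  have h3 := pow_le_pow_left₀ hK h2 2
  rw [mul_pow, hss] at h3
  rw [ge_iff_le, div_le_iff₀ (by positivity)]
  nlinarith [mul_pos hpos (pow_pos c0 2)]

lemma sob_le (w : E4 → ℝ) (hw : ContDiff ℝ (⊤ : ℕ∞) w) (hc : HasCompactSupport w) :
    sobolevS * √(∫ x, (w x) ^ 4) ≤ ∫ x, gradSq w x := by
  have hG : 0 ≤ ∫ x, gradSq w x := integral_nonneg fun x => by unfold gradSq; positivity
  by_cases h : (∫ x, (w x) ^ 4) ≤ 0
  · rw [Real.sqrt_eq_zero'.2 h]; simpa using hG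
  push Not at h
  have hw0 : w ≠ 0 := by rintro rfl; simp at h
  rw [← le_div_iff₀ (Real.sqrt_pos.2 h), Real.sqrt_eq_rpow]
  refine csInf_le ⟨0, ?_⟩ ⟨w, hw, hc, hw0, rfl⟩
  rintro r ⟨f, -, -, -, rfl⟩
  exact div_nonneg (integral_nonneg fun x => by unfold gradSq; positivity)
    (Real.rpow_nonneg (integral_nonneg fun x => by positivity) _)

lemma sob_nonneg : 0 ≤ sobolevS := by
  apply Real.sInf_nonneg
  rintro r ⟨f, -, -, -, rfl⟩
  exact div_nonneg (integral_nonneg fun x => by unfold gradSq; positivity)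
    (Real.rpow_nonneg (integral_nonneg fun x => by positivity) _)

/-- Lemma 3.2 of the paper: a uniform lower `L⁴` bound on the set `𝓜`, with the
explicit constant `S²/(2C²)`, `C = max{μ₁+β+θ₁e^{λ₁/θ₁−1}, μ₂+β+θ₂e^{λ₂/θ₂−1}}`. -/
theorem stmt_11 (Ω : Set E4) (hΩne : Ω.Nonempty) (hΩo : IsOpen Ω)
    (hΩb : Bornology.IsBounded Ω)
    (lam1 lam2 μ₁ μ₂ θ₁ θ₂ β : ℝ) (hμ₁ : 0 < μ₁) (hμ₂ : 0 < μ₂)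
    (hθ₁ : 0 < θ₁) (hθ₂ : 0 < θ₂) (hβ : 0 < β) :
    (∀ u v : E4 → ℝ, TestFun Ω u → TestFun Ω v → ¬(u = 0 ∧ v = 0) →
      LLp Ω lam1 μ₁ θ₁ lam2 μ₂ θ₂ β u v = 0 →
      (∫ x in Ω, (pp u x) ^ 4) + (∫ x in Ω, (pp v x) ^ 4) ≥
        sobolevS ^ 2 / (2 * (max (μ₁ + β + θ₁ * Real.exp (lam1 / θ₁ - 1))
          (μ₂ + β + θ₂ * Real.exp (lam2 / θ₂ - 1))) ^ 2)) ∧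
    (∃ C₃ : ℝ, 0 < C₃ ∧
      ∀ u v : E4 → ℝ, TestFun Ω u → TestFun Ω v → ¬(u = 0 ∧ v = 0) →
        LLp Ω lam1 μ₁ θ₁ lam2 μ₂ θ₂ β u v = 0 →
        (∫ x in Ω, (pp u x) ^ 4) + (∫ x in Ω, (pp v x) ^ 4) ≥ C₃) := by
  refine ⟨fun u v hu hv hne hL => core Ω lam1 lam2 μ₁ μ₂ θ₁ θ₂ β hμ₁ hθ₁ hθ₂ hβ sobolevS
    sob_nonneg sob_le u v hu hv hne hL, ?_⟩
  obtain ⟨c, hc, hcS⟩ := gns_aux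
  refine ⟨_, ?_, fun u v hu hv hne hL => core Ω lam1 lam2 μ₁ μ₂ θ₁ θ₂ β hμ₁ hθ₁ hθ₂ hβ c
    hc.le hcS u v hu hv hne hL⟩
  have c0 : 0 < max (μ₁ + β + θ₁ * Real.exp (lam1 / θ₁ - 1))
          (μ₂ + β + θ₂ * Real.exp (lam2 / θ₂ - 1)) :=
    lt_of_lt_of_le (by positivity) (le_max_left _ _)
  positivity
end
end

section
/- Let Ω be a nonempty bounded open subset of ℝ⁴, let λ₁, λ₂, β ∈ ℝ, μ₁, μ₂ > 0 and θ₁, θ₂ < 0. Then for every ρ > 0 the infimum C_ρ := inf{ ℒ(u,v) : u, v ∈ C_c^∞(Ω), ∫_Ω|∇u|² + ∫_Ω|∇v|² < ρ² } satisfies −∞ < C_ρ < 0. -/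
open MeasureTheory

noncomputable section

lemma aux_supp {Ω : Set E4} {u : E4 → ℝ} (hu : TestFun Ω u) {x : E4} (hx : x ∉ Ω) : u x = 0 :=
  image_eq_zero_of_notMem_tsupport (fun h => hx (hu.2.2 h))

lemma aux_gradSq_cont {Ω : Set E4} {u : E4 → ℝ} (hu : TestFun Ω u) :
    Continuous (fderiv ℝ u) :=
  hu.1.continuous_fderiv (by simp)

lemma aux_cs {Ω : Set E4} {u : E4 → ℝ} (hu : TestFun Ω u) {g : ℝ → ℝ} (hg0 : g 0 = 0) :
    HasCompactSupport (fun x => g (u x)) :=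
  hu.2.1.comp_left (g := g) hg0

lemma aux_int {Ω : Set E4} {u : E4 → ℝ} (hu : TestFun Ω u) {g : ℝ → ℝ} (hg : Continuous g)
    (hg0 : g 0 = 0) : Integrable (fun x => g (u x)) :=
  (hg.comp hu.1.continuous).integrable_of_hasCompactSupport (aux_cs hu hg0)

lemma aux_sobolev (Ω : Set E4) : ∃ C : ℝ, 0 ≤ C ∧ ∀ u, TestFun Ω u →
    ∫ x in Ω, (u x) ^ 4 ≤ C * (∫ x in Ω, gradSq u x) ^ 2 := by
  let C0 : NNReal := SNormLESNormFDerivOfEqConst ℝ (volume : Measure E4) (2 : NNReal)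
  refine ⟨(C0 : ℝ) ^ 4, by positivity, fun u hu => ?_⟩
  have h := eLpNorm_le_eLpNorm_fderiv_of_eq (volume : Measure E4) (u := u)
    (hu.1.of_le (by exact_mod_cast le_top)) hu.2.1 (p := 2) (p' := 4) (by norm_num)
    (by simp) (by simp; norm_num)
  have m1 : MemLp u ((4 : NNReal) : ENNReal) (volume : Measure E4) :=
    hu.1.continuous.memLp_of_hasCompactSupport hu.2.1
  have m2 : MemLp (fderiv ℝ u) ((2 : NNReal) : ENNReal) (volume : Measure E4) :=
    (aux_gradSq_cont hu).memLp_of_hasCompactSupport (hu.2.1.fderiv (𝕜 := ℝ))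
  rw [m1.eLpNorm_eq_integral_rpow_norm (by simp) (by simp),
    m2.eLpNorm_eq_integral_rpow_norm (by simp) (by simp)] at h
  have e1 : ∫ x in Ω, (u x) ^ 4 = ∫ x, ‖u x‖ ^ (((4 : NNReal) : ENNReal).toReal) := by
    rw [setIntegral_eq_integral_of_forall_compl_eq_zero]
    · congr 1
      ext x
      have : (((4 : NNReal) : ENNReal).toReal) = ((4 : ℕ) : ℝ) := by simp
      rw [this, Real.rpow_natCast, Real.norm_eq_abs, Even.pow_abs (by decide)]
    · intro x hx
      simp [aux_supp hu hx]
  have e2 : ∫ x in Ω, gradSq u x = ∫ x, ‖fderiv ℝ u x‖ ^ (((2 : NNReal) : ENNReal).toReal) := by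
    rw [setIntegral_eq_integral_of_forall_compl_eq_zero]
    · congr 1
      ext x
      have : (((2 : NNReal) : ENNReal).toReal) = ((2 : ℕ) : ℝ) := by simp
      rw [this, Real.rpow_natCast, gradSq]
    · intro x hx
      simp [gradSq, fderiv_of_notMem_tsupport ℝ (fun h => hx (hu.2.2 h))]
  rw [← e1, ← e2] at h
  have hA : 0 ≤ ∫ x in Ω, (u x) ^ 4 := integral_nonneg (fun x => by positivity)
  have hB : 0 ≤ ∫ x in Ω, gradSq u x := integral_nonneg (fun x => by unfold gradSq; positivity)
  generalize (∫ x in Ω, (u x) ^ 4) = A at *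
  generalize (∫ x in Ω, gradSq u x) = B at *
  change _ ≤ (C0 : ENNReal) * _ at h
  rw [← ENNReal.ofReal_coe_nnreal (p := C0), ← ENNReal.ofReal_mul (by positivity),
    ENNReal.ofReal_le_ofReal_iff (by positivity)] at h
  have h4 := pow_le_pow_left₀ (by positivity) h 4
  have a1 : (A ^ (((4 : NNReal) : ENNReal).toReal)⁻¹) ^ 4 = A := by
    rw [← Real.rpow_natCast, ← Real.rpow_mul hA]; simp
  have a2 : (B ^ (((2 : NNReal) : ENNReal).toReal)⁻¹) ^ 4 = B ^ 2 := by
    rw [← Real.rpow_natCast, ← Real.rpow_mul hB, ← Real.rpow_natCast]; congr 1; simp; norm_num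
  rwa [mul_pow, a1, a2] at h4

lemma aux_log (t : ℝ) (ht : 0 ≤ t) : -1 ≤ t * (Real.log t - 1) := by
  rcases ht.eq_or_lt with rfl | h
  · simp
  · have := Real.one_sub_inv_le_log_of_pos h
    have h2 := mul_le_mul_of_nonneg_left this ht
    have : t * t⁻¹ = 1 := mul_inv_cancel₀ h.ne'
    nlinarith

lemma aux_logcont : Continuous fun s : ℝ => (max s 0) ^ 2 * (Real.log ((max s 0) ^ 2) - 1) := by
  have h : Continuous fun s : ℝ => (max s 0) ^ 2 := by fun_prop
  have := (Real.continuous_mul_log.comp h).sub h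
  refine this.congr fun s => ?_
  show (max s 0) ^ 2 * Real.log ((max s 0) ^ 2) - (max s 0) ^ 2 = _
  ring

/-- all the bounds for one function. -/
lemma aux_bounds (Ω : Set E4) (hΩb : Bornology.IsBounded Ω) (ρ : ℝ) :
    ∃ K : ℝ, 0 ≤ K ∧ ∀ u, TestFun Ω u → ∫ x in Ω, gradSq u x ≤ ρ ^ 2 →
      (∫ x in Ω, (pp u x) ^ 2 ≤ K) ∧ (∫ x in Ω, (pp u x) ^ 4 ≤ K) ∧
      (-K ≤ ∫ x in Ω, (pp u x) ^ 2 * (Real.log ((pp u x) ^ 2) - 1)) := by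
  obtain ⟨C, hC, hS⟩ := aux_sobolev Ω
  have hfin : volume Ω ≠ ⊤ := hΩb.measure_lt_top.ne
  have hconst : ∀ c : ℝ, IntegrableOn (fun _ : E4 => c) Ω volume :=
    fun c => integrableOn_const hfin
  have hM : 0 ≤ volume.real Ω := measureReal_nonneg
  refine ⟨volume.real Ω + C * (ρ ^ 2) ^ 2, by positivity, fun u hu hg => ?_⟩
  have hB : 0 ≤ ∫ x in Ω, gradSq u x := integral_nonneg (fun x => by unfold gradSq; positivity)
  have i4 : IntegrableOn (fun x => (pp u x) ^ 4) Ω :=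
    (aux_int hu (g := fun s => (max s 0) ^ 4) (by fun_prop) (by simp)).integrableOn
  have i2 : IntegrableOn (fun x => (pp u x) ^ 2) Ω :=
    (aux_int hu (g := fun s => (max s 0) ^ 2) (by fun_prop) (by simp)).integrableOn
  have iu : IntegrableOn (fun x => (u x) ^ 4) Ω :=
    (aux_int hu (g := fun s => s ^ 4) (by fun_prop) (by simp)).integrableOn
  have il : IntegrableOn (fun x => (pp u x) ^ 2 * (Real.log ((pp u x) ^ 2) - 1)) Ω :=
    (aux_int hu aux_logcont (by simp)).integrableOn
  have h4 : ∫ x in Ω, (pp u x) ^ 4 ≤ C * (ρ ^ 2) ^ 2 := by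
    calc ∫ x in Ω, (pp u x) ^ 4 ≤ ∫ x in Ω, (u x) ^ 4 := by
          refine integral_mono i4 iu fun x => ?_
          simp only [pp]
          rcases le_total (u x) 0 with h | h
          · rw [max_eq_right h]; simp; positivity
          · rw [max_eq_left h]
      _ ≤ _ := hS u hu
      _ ≤ _ := by gcongr
  refine ⟨?_, by linarith, ?_⟩
  · calc ∫ x in Ω, (pp u x) ^ 2 ≤ ∫ x in Ω, (1 + (pp u x) ^ 4) :=
          integral_mono i2 (Integrable.add (hconst 1) i4) fun x => by
            show _ ≤ 1 + _
            nlinarith [sq_nonneg ((pp u x) ^ 2 - 1), sq_nonneg ((pp u x) ^ 2)]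
      _ = volume.real Ω + ∫ x in Ω, (pp u x) ^ 4 := by
          rw [integral_add (hconst 1) i4]; simp
      _ ≤ _ := by linarith
  · have : ∫ x in Ω, (-1 : ℝ) ≤ ∫ x in Ω, (pp u x) ^ 2 * (Real.log ((pp u x) ^ 2) - 1) :=
      integral_mono (hconst _) il fun x => aux_log _ (sq_nonneg _)
    have h0 : 0 ≤ C * (ρ ^ 2) ^ 2 := by positivity
    rw [setIntegral_const, smul_eq_mul] at this
    linarith

lemma aux_mul (c a K : ℝ) (h0 : 0 ≤ a) (h : a ≤ K) : -(|c| * K) ≤ -(c * a) := by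
  have : c * a ≤ |c| * a := mul_le_mul_of_nonneg_right (le_abs_self c) h0
  have : |c| * a ≤ |c| * K := mul_le_mul_of_nonneg_left h (abs_nonneg c)
  linarith

lemma aux_bdd (Ω : Set E4) (hΩb : Bornology.IsBounded Ω)
    (lam1 lam2 μ₁ μ₂ θ₁ θ₂ β : ℝ)
    (hθ₁ : θ₁ < 0) (hθ₂ : θ₂ < 0) (ρ : ℝ) :
    BddBelow { r : ℝ | ∃ u v : E4 → ℝ, TestFun Ω u ∧ TestFun Ω v ∧
        (∫ x in Ω, gradSq u x) + (∫ x in Ω, gradSq v x) < ρ ^ 2 ∧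
        r = LL Ω lam1 μ₁ θ₁ lam2 μ₂ θ₂ β u v } := by
  obtain ⟨K, hK, hb⟩ := aux_bounds Ω hΩb ρ
  refine ⟨-(|lam1 / 2| * K) - |μ₁ / 4| * K + (θ₁ / 2) * K - |lam2 / 2| * K - |μ₂ / 4| * K
    + (θ₂ / 2) * K - |β / 2| * (K + K), ?_⟩
  rintro r ⟨u, v, hu, hv, hlt, rfl⟩
  have hgu : 0 ≤ ∫ x in Ω, gradSq u x := integral_nonneg (fun x => by unfold gradSq; positivity)
  have hgv : 0 ≤ ∫ x in Ω, gradSq v x := integral_nonneg (fun x => by unfold gradSq; positivity)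
  obtain ⟨u2, u4, ul⟩ := hb u hu (by linarith)
  obtain ⟨v2, v4, vl⟩ := hb v hv (by linarith)
  have i4 : ∀ w, TestFun Ω w → IntegrableOn (fun x => (pp w x) ^ 4) Ω := fun w hw =>
    (aux_int hw (g := fun s => (max s 0) ^ 4) (by fun_prop) (by simp)).integrableOn
  have huv : ∫ x in Ω, (pp u x) ^ 2 * (pp v x) ^ 2 ≤ K + K := by
    calc ∫ x in Ω, (pp u x) ^ 2 * (pp v x) ^ 2 ≤ ∫ x in Ω, ((pp u x) ^ 4 + (pp v x) ^ 4) := by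
          refine integral_mono_of_nonneg (Filter.Eventually.of_forall fun x => ?_)
            ((i4 u hu).add (i4 v hv)) (Filter.Eventually.of_forall fun x => ?_)
          · show (0:ℝ) ≤ _
            positivity
          · show _ ≤ (pp u x) ^ 4 + (pp v x) ^ 4
            nlinarith [sq_nonneg ((pp u x) ^ 2 - (pp v x) ^ 2), sq_nonneg ((pp u x) ^ 2),
              sq_nonneg ((pp v x) ^ 2)]
      _ = _ := integral_add (i4 u hu) (i4 v hv)
      _ ≤ _ := add_le_add u4 v4
  have p2 : ∀ w, 0 ≤ ∫ x in Ω, (pp w x) ^ 2 := fun w => integral_nonneg fun x => by positivity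
  have p4 : ∀ w, 0 ≤ ∫ x in Ω, (pp w x) ^ 4 := fun w => integral_nonneg fun x => by positivity
  have puv : 0 ≤ ∫ x in Ω, (pp u x) ^ 2 * (pp v x) ^ 2 := integral_nonneg fun x => by positivity
  have b1 := aux_mul (lam1 / 2) _ _ (p2 u) u2
  have b2 := aux_mul (lam2 / 2) _ _ (p2 v) v2
  have b3 := aux_mul (μ₁ / 4) _ _ (p4 u) u4
  have b4 := aux_mul (μ₂ / 4) _ _ (p4 v) v4
  have b5 := aux_mul (β / 2) _ _ puv huv
  have b6 := mul_le_mul_of_nonneg_left ul (by linarith : 0 ≤ -(θ₁ / 2))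
  have b7 := mul_le_mul_of_nonneg_left vl (by linarith : 0 ≤ -(θ₂ / 2))
  unfold LL
  linarith

lemma aux_neg (Ω : Set E4) (hΩne : Ω.Nonempty) (hΩo : IsOpen Ω)
    (lam1 lam2 μ₁ μ₂ θ₁ θ₂ β : ℝ) (hμ₁ : 0 < μ₁)
    (hθ₁ : θ₁ < 0) (ρ : ℝ) (hρ : 0 < ρ) :
    ∃ u v : E4 → ℝ, TestFun Ω u ∧ TestFun Ω v ∧
        (∫ x in Ω, gradSq u x) + (∫ x in Ω, gradSq v x) < ρ ^ 2 ∧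
        LL Ω lam1 μ₁ θ₁ lam2 μ₂ θ₂ β u v < 0 := by
  obtain ⟨x0, hx0⟩ := hΩne
  obtain ⟨f, fs, fc, fd, fr, f1⟩ :=
    exists_contDiff_tsupport_subset (n := (⊤ : ℕ∞)) (hΩo.mem_nhds hx0)
  have f0 : ∀ x, 0 ≤ f x := fun x => (fr ⟨x, rfl⟩).1
  have hf : TestFun Ω f := ⟨fd, fc, fs⟩
  have i2 : IntegrableOn (fun x => (f x) ^ 2) Ω :=
    (aux_int hf (g := fun s => s ^ 2) (by fun_prop) (by simp)).integrableOn
  have il : IntegrableOn (fun x => (f x) ^ 2 * (Real.log ((f x) ^ 2) - 1)) Ω := by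
    have := (aux_int hf aux_logcont (by simp)).integrableOn (s := Ω)
    refine this.congr_fun_ae (Filter.Eventually.of_forall fun x => ?_)
    simp [max_eq_left (f0 x)]
  have hB : 0 < ∫ x in Ω, (f x) ^ 2 := by
    rw [setIntegral_eq_integral_of_forall_compl_eq_zero
      (fun x hx => by simp [aux_supp hf hx])]
    exact integral_pos_of_integrable_nonneg_nonzero (x := x0) (by fun_prop)
      (aux_int hf (g := fun s => s ^ 2) (by fun_prop) (by simp)) (fun x => sq_nonneg _)
      (by simp [f1])
  set A := ∫ x in Ω, gradSq f x with hA
  set B := ∫ x in Ω, (f x) ^ 2 with hBdef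
  set D := ∫ x in Ω, (f x) ^ 4 with hD
  set F := ∫ x in Ω, (f x) ^ 2 * (Real.log ((f x) ^ 2) - 1) with hF
  have hD0 : 0 ≤ D := integral_nonneg fun x => by positivity
  have hgrad : ∀ t : ℝ, ∫ x in Ω, gradSq (fun y => t * f y) x = t ^ 2 * A := by
    intro t
    rw [hA, ← integral_const_mul]
    congr 1
    ext x
    have hd : DifferentiableAt ℝ f x := fd.contDiffAt.differentiableAt (by simp)
    simp only [gradSq]
    rw [fderiv_const_mul hd, norm_smul, mul_pow, Real.norm_eq_abs, sq_abs]
  have hpp : ∀ t : ℝ, 0 < t → ∀ x, pp (fun y => t * f y) x = t * f x := fun t ht x =>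
    max_eq_left (mul_nonneg ht.le (f0 x))
  have hpz : ∀ x, pp (fun _ => 0) x = 0 := fun x => by simp [pp]
  have hgz : ∀ x, gradSq (fun _ => 0) x = 0 := fun x => by simp [gradSq]
  have key : ∀ t : ℝ, 0 < t → LL Ω lam1 μ₁ θ₁ lam2 μ₂ θ₂ β (fun y => t * f y) (fun _ => 0)
      = t ^ 2 / 2 * (A - lam1 * B - μ₁ / 2 * t ^ 2 * D - θ₁ * F - θ₁ * B * (2 * Real.log t)) := by
    intro t ht
    have c2 : ∫ x in Ω, (t * f x) ^ 2 = t ^ 2 * B := by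
      rw [hBdef, ← integral_const_mul]; congr 1; ext x; ring
    have c4 : ∫ x in Ω, (t * f x) ^ 4 = t ^ 4 * D := by
      rw [hD, ← integral_const_mul]; congr 1; ext x; ring
    have cl : ∫ x in Ω, (t * f x) ^ 2 * (Real.log ((t * f x) ^ 2) - 1)
        = t ^ 2 * F + t ^ 2 * (2 * Real.log t) * B := by
      rw [hF, hBdef, ← integral_const_mul, ← integral_const_mul,
        ← integral_add (il.const_mul _) (i2.const_mul _)]
      congr 1; ext x
      by_cases h : f x = 0
      · simp [h]
      · rw [mul_pow, Real.log_mul (by positivity) (by positivity), Real.log_pow t 2]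
        push_cast
        ring
    simp only [LL, hpp t ht, hpz, hgz, hgrad, c2, c4, cl]
    simp
    ring
  have l1 : Filter.Tendsto (fun t : ℝ => t ^ 2 * A) (nhdsWithin 0 (Set.Ioi 0)) (nhds 0) := by
    have : Continuous fun t : ℝ => t ^ 2 * A := by fun_prop
    have h := this.tendsto 0
    simp only [ne_eq, OfNat.ofNat_ne_zero, not_false_eq_true, zero_pow, zero_mul] at h
    exact h.mono_left nhdsWithin_le_nhds
  have e1 := l1.eventually_lt_const (show (0:ℝ) < ρ ^ 2 by positivity)
  have e2 := Real.tendsto_log_nhdsGT_zero.eventually_lt_atBot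
    ((A - lam1 * B - θ₁ * F) / (2 * θ₁ * B))
  obtain ⟨t, ⟨h1, h2⟩, ht⟩ := ((e1.and e2).and self_mem_nhdsWithin).exists
  have ht : 0 < t := ht
  refine ⟨fun y => t * f y, fun _ => 0, ⟨contDiff_const.mul fd, fc.mul_left, ?_⟩,
    ⟨contDiff_const, HasCompactSupport.zero, by simp [tsupport]⟩, ?_, ?_⟩
  · exact (closure_mono (Function.support_mul_subset_right _ _)).trans fs
  · simpa [hgrad, hgz] using h1
  · rw [key t ht]
    refine mul_neg_of_pos_of_neg (by positivity) ?_
    rw [lt_div_iff_of_neg (by nlinarith)] at h2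
    have : 0 ≤ μ₁ / 2 * t ^ 2 * D := by positivity
    linarith

/-- Lemma 4.2 of the paper: for `θ₁, θ₂ < 0` and any `ρ > 0`, the local infimum
`C_ρ = inf{ℒ(u,v) : ∫|∇u|² + ∫|∇v|² < ρ²}` satisfies `−∞ < C_ρ < 0`. -/
theorem stmt_13 (Ω : Set E4) (hΩne : Ω.Nonempty) (hΩo : IsOpen Ω)
    (hΩb : Bornology.IsBounded Ω)
    (lam1 lam2 μ₁ μ₂ θ₁ θ₂ β : ℝ) (hμ₁ : 0 < μ₁) (hμ₂ : 0 < μ₂)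
    (hθ₁ : θ₁ < 0) (hθ₂ : θ₂ < 0) (ρ : ℝ) (hρ : 0 < ρ) :
    BddBelow { r : ℝ | ∃ u v : E4 → ℝ, TestFun Ω u ∧ TestFun Ω v ∧
        (∫ x in Ω, gradSq u x) + (∫ x in Ω, gradSq v x) < ρ ^ 2 ∧
        r = LL Ω lam1 μ₁ θ₁ lam2 μ₂ θ₂ β u v } ∧
    sInf { r : ℝ | ∃ u v : E4 → ℝ, TestFun Ω u ∧ TestFun Ω v ∧
        (∫ x in Ω, gradSq u x) + (∫ x in Ω, gradSq v x) < ρ ^ 2 ∧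
        r = LL Ω lam1 μ₁ θ₁ lam2 μ₂ θ₂ β u v } < 0 := by
  have hb := aux_bdd Ω hΩb lam1 lam2 μ₁ μ₂ θ₁ θ₂ β hθ₁ hθ₂ ρ
  refine ⟨hb, ?_⟩
  obtain ⟨u, v, hu, hv, h1, h2⟩ :=
    aux_neg Ω hΩne hΩo lam1 lam2 μ₁ μ₂ θ₁ θ₂ β hμ₁ hθ₁ ρ hρ
  exact (csInf_le hb ⟨u, v, hu, hv, h1, rfl⟩).trans_lt h2
end
end

section
/- Let Ω be a nonempty bounded open subset of ℝ⁴ with Lebesgue measure |Ω|, let λ₁, λ₂, β ∈ ℝ, μ₁, μ₂ ∈ ℝ and θ₁, θ₂ < 0. Then for all u, v ∈ C_c^∞(Ω): ℒ(u,v) − (1/4)ℒ'(u,v)(u,v) ≥ (1/4)(∫_Ω|∇u|² + ∫_Ω|∇v|²) + (θ₁/4)e^{1−λ₁/θ₁}|Ω| + (θ₂/4)e^{1−λ₂/θ₂}|Ω|. -/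
open MeasureTheory

noncomputable section

theorem aux_pt (a s : ℝ) (hs : 0 ≤ s) :
    0 ≤ s * Real.log s - (2 - a) * s + Real.exp (1 - a) := by
  rcases hs.eq_or_lt with h | h
  · subst h
    simp
    positivity
  · have h1 := Real.add_one_le_exp (1 - a - Real.log s)
    rw [Real.exp_sub, Real.exp_log h, le_div_iff₀ h] at h1
    nlinarith

theorem aux_int_s14 (Ω : Set E4) (hΩo : IsOpen Ω) (hΩb : Bornology.IsBounded Ω)
    (lam θ : ℝ) (hθ : θ < 0) (u : E4 → ℝ) (hu : TestFun Ω u) :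
    (θ / 4) * Real.exp (1 - lam / θ) * (volume Ω).toReal ≤
    - (lam / 4) * (∫ x in Ω, (pp u x) ^ 2)
    - (θ / 2) * (∫ x in Ω, (pp u x) ^ 2 * (Real.log ((pp u x) ^ 2) - 1))
    + (θ / 4) * (∫ x in Ω, (pp u x) ^ 2 * Real.log ((pp u x) ^ 2)) := by
  have hfin : volume Ω ≠ ⊤ := hΩb.measure_lt_top.ne
  have hc : Continuous (fun x => pp u x) := hu.1.continuous.max continuous_const
  have hcs : HasCompactSupport (fun x => pp u x) := by
    have := hu.2.1.comp_left (g := fun y : ℝ => max y 0) (by simp)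
    exact this
  have i1 : Integrable (fun x => (pp u x) ^ 2) (volume.restrict Ω) := by
    have hk : HasCompactSupport (fun x => (pp u x) ^ 2) :=
      hcs.comp_left (g := fun y : ℝ => y ^ 2) (by simp)
    have hq : Continuous (fun x => (pp u x) ^ 2) := hc.pow 2
    have hi : Integrable (fun x => (pp u x) ^ 2) (volume : Measure E4) :=
      hq.integrable_of_hasCompactSupport hk
    exact hi.restrict
  have i2 : Integrable (fun x => (pp u x) ^ 2 * Real.log ((pp u x) ^ 2))
      (volume.restrict Ω) := by
    have hk : HasCompactSupport (fun x => (pp u x) ^ 2 * Real.log ((pp u x) ^ 2)) :=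
      hcs.comp_left (g := fun y : ℝ => y ^ 2 * Real.log (y ^ 2)) (by simp)
    have hq : Continuous (fun x => (pp u x) ^ 2 * Real.log ((pp u x) ^ 2)) :=
      Real.continuous_mul_log.comp (hc.pow 2)
    have hi : Integrable (fun x => (pp u x) ^ 2 * Real.log ((pp u x) ^ 2))
        (volume : Measure E4) :=
      hq.integrable_of_hasCompactSupport hk
    exact hi.restrict
  have e1 : ∫ x in Ω, (pp u x) ^ 2 * (Real.log ((pp u x) ^ 2) - 1)
      = (∫ x in Ω, (pp u x) ^ 2 * Real.log ((pp u x) ^ 2)) - ∫ x in Ω, (pp u x) ^ 2 := by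
    rw [← integral_sub i2 i1]
    congr 1
    ext x
    ring
  have i3 : Integrable (fun _ : E4 => Real.exp (1 - lam / θ)) (volume.restrict Ω) :=
    integrableOn_const hfin
  have i4 := i1.const_mul (2 - lam / θ)
  have key : 0 ≤ ∫ x in Ω, ((pp u x) ^ 2 * Real.log ((pp u x) ^ 2)
      - (2 - lam / θ) * (pp u x) ^ 2 + Real.exp (1 - lam / θ)) :=
    integral_nonneg fun x => aux_pt _ _ (sq_nonneg _)
  have i5 : Integrable (fun x => (pp u x) ^ 2 * Real.log ((pp u x) ^ 2)
      - (2 - lam / θ) * (pp u x) ^ 2) (volume.restrict Ω) := i2.sub i4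
  rw [integral_add i5 i3, integral_sub i2 i4, integral_const_mul,
    setIntegral_const, smul_eq_mul, Measure.real] at key
  rw [e1]
  generalize (∫ x in Ω, (pp u x) ^ 2 * Real.log ((pp u x) ^ 2)) = A at *
  generalize (∫ x in Ω, (pp u x) ^ 2) = B at *
  have hl : lam = θ * (lam / θ) := by have := hθ.ne; field_simp
  generalize lam / θ = a at *
  subst hl
  nlinarith

/-- Core inequality of Lemma 4.3 (boundedness of Palais–Smale sequences): for
`θ₁, θ₂ < 0`,
`ℒ(u,v) − ¼ℒ'(u,v)(u,v) ≥ ¼(∫|∇u|² + ∫|∇v|²) + ¼θ₁e^{1−λ₁/θ₁}|Ω| + ¼θ₂e^{1−λ₂/θ₂}|Ω|`. -/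
theorem stmt_14 (Ω : Set E4) (hΩne : Ω.Nonempty) (hΩo : IsOpen Ω)
    (hΩb : Bornology.IsBounded Ω)
    (lam1 lam2 μ₁ μ₂ θ₁ θ₂ β : ℝ) (hθ₁ : θ₁ < 0) (hθ₂ : θ₂ < 0)
    (u v : E4 → ℝ) (hu : TestFun Ω u) (hv : TestFun Ω v) :
    LL Ω lam1 μ₁ θ₁ lam2 μ₂ θ₂ β u v -
        (1 / 4) * LLp Ω lam1 μ₁ θ₁ lam2 μ₂ θ₂ β u v ≥
      (1 / 4) * ((∫ x in Ω, gradSq u x) + (∫ x in Ω, gradSq v x)) +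
        (θ₁ / 4) * Real.exp (1 - lam1 / θ₁) * (volume Ω).toReal +
        (θ₂ / 4) * Real.exp (1 - lam2 / θ₂) * (volume Ω).toReal := by
  have h1 := aux_int_s14 Ω hΩo hΩb lam1 θ₁ hθ₁ u hu
  have h2 := aux_int_s14 Ω hΩo hΩb lam2 θ₂ hθ₂ v hv
  unfold LL LLp
  linarith
end
end
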